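/- Let g : [0,a₀] → [0,∞) be Lipschitz with graph Γ, and for 0 ≤ a₁ < a₂ ≤ a₀ and b > 0 set Γ(a₁,a₂) := graph of g over (a₁,a₂) and R(a₁,a₂,b) := { (x,y) : x ∈ (a₁,a₂), g(x) < y < g(x)+b }. Then K(Γ(a₁,a₂), R(a₁,a₂,b)) ≥ (1 + ‖g'‖_∞²)^{-3/2} · π / (2(a₂ − a₁)). In particular K(Γ(a₁,a₂), R(a₁,a₂,b)) → +∞ as a₂ − a₁ → 0, uniformly in b. -/

import Mathlib

open Real Set MeasureTheory

/-- partial derivative in the first coordinate -/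
noncomputable def pdX (v : ℝ × ℝ → ℝ) (p : ℝ × ℝ) : ℝ := deriv (fun a => v (a, p.2)) p.1

/-- partial derivative in the second coordinate -/
noncomputable def pdY (v : ℝ × ℝ → ℝ) (p : ℝ × ℝ) : ℝ := deriv (fun b => v (p.1, b)) p.2

/-- Dirichlet energy `∫_A |∇v|²` -/
noncomputable def energy (A : Set (ℝ × ℝ)) (v : ℝ × ℝ → ℝ) : ℝ :=
  ∫ p in A, ((pdX v p) ^ 2 + (pdY v p) ^ 2)

/-- boundary integral `∫_Γ v² dH¹` -/
noncomputable def bInt (Γ : Set (ℝ × ℝ)) (v : ℝ × ℝ → ℝ) : ℝ :=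
  ∫ p in Γ, (v p) ^ 2 ∂(μH[1])

/-- admissible competitors for the variational problem defining `K(Γ,A)`:
`v ∈ H¹(A)`, `∫_Γ v² dH¹ = 1`, `v = 0` on `∂A∖Γ` -/
def Adm (A Γ : Set (ℝ × ℝ)) : Set ((ℝ × ℝ) → ℝ) :=
  {v | ContinuousOn v (closure A) ∧ DifferentiableOn ℝ v A ∧
    MeasureTheory.IntegrableOn (fun p => (pdX v p) ^ 2 + (pdY v p) ^ 2) A ∧
    bInt Γ v = 1 ∧ ∀ p ∈ frontier A \ Γ, v p = 0}

/-- the quantity `K(Γ,A)` of the paper -/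
noncomputable def Kconst (Γ A : Set (ℝ × ℝ)) : ℝ := sInf (energy A '' Adm A Γ)

/-- a planar open set has Lipschitz boundary: near each boundary point, after a
rotation, the set is the open region above the graph of a Lipschitz function -/
def HasLipschitzBoundary (A : Set (ℝ × ℝ)) : Prop :=
  ∀ p ∈ frontier A, ∃ (θ : ℝ) (g : ℝ → ℝ) (L r : ℝ), 0 < r ∧
    LipschitzWith (Real.toNNReal L) g ∧
    ∀ q ∈ Metric.ball p r,
      (q ∈ A ↔ g (Real.cos θ * (q.1 - p.1) + Real.sin θ * (q.2 - p.2)) <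
        (- Real.sin θ * (q.1 - p.1) + Real.cos θ * (q.2 - p.2)))

/-- the graph of `g` over `(a₁,a₂)` -/
def graphSet (g : ℝ → ℝ) (a₁ a₂ : ℝ) : Set (ℝ × ℝ) :=
  {p : ℝ × ℝ | p.1 ∈ Ioo a₁ a₂ ∧ p.2 = g p.1}

/-- the region of height `b` above the graph of `g` over `(a₁,a₂)` -/
def graphRegion (g : ℝ → ℝ) (a₁ a₂ b : ℝ) : Set (ℝ × ℝ) :=
  {p : ℝ × ℝ | p.1 ∈ Ioo a₁ a₂ ∧ g p.1 < p.2 ∧ p.2 < g p.1 + b}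

theorem integrableOn_of_sq_add_sq {K : Set (ℝ × ℝ)} (hK : IsCompact K) {f h : ℝ × ℝ → ℝ}
    (hf : Measurable f) (hi : IntegrableOn (fun p => f p ^ 2 + h p ^ 2) K) :
    IntegrableOn f K := by
  have hfin : IsFiniteMeasure ((volume : Measure (ℝ × ℝ)).restrict K) :=
    ⟨by simpa using hK.measure_lt_top⟩
  have h2 : MemLp f 2 ((volume : Measure (ℝ × ℝ)).restrict K) := by
    rw [memLp_two_iff_integrable_sq hf.aestronglyMeasurable]
    refine Integrable.mono' hi (hf.pow_const 2).aestronglyMeasurable (.of_forall fun p => ?_)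
    rw [Real.norm_of_nonneg (sq_nonneg _)]
    nlinarith [sq_nonneg (h p)]
  exact h2.integrable one_le_two

theorem rectangle_trace_le {a₁ a₂ β c : ℝ} (ha : a₁ < a₂) (hβ : 0 < β) (hc : 0 < c)
    (hcπ : c * (a₂ - a₁) < π) {w : ℝ × ℝ → ℝ}
    (hw : ContinuousOn w (Icc a₁ a₂ ×ˢ Icc 0 β))
    (hd : DifferentiableOn ℝ w (Ioo a₁ a₂ ×ˢ Ioo 0 β))
    (h₁ : ∀ t ∈ Icc 0 β, w (a₁, t) = 0) (h₂ : ∀ t ∈ Icc 0 β, w (a₂, t) = 0)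
    (hi : IntegrableOn (fun p => (fderiv ℝ w p (1, 0)) ^ 2 + (fderiv ℝ w p (0, 1)) ^ 2)
      (Ioo a₁ a₂ ×ˢ Ioo 0 β)) :
    c * ((∫ x in a₁..a₂, w (x, 0) ^ 2) - ∫ x in a₁..a₂, w (x, β) ^ 2) ≤
      ∫ p in Ioo a₁ a₂ ×ˢ Ioo 0 β,
        ((fderiv ℝ w p (1, 0)) ^ 2 + (fderiv ℝ w p (0, 1)) ^ 2) := by
  set m : ℝ := (a₁ + a₂) / 2 with hm
  have hIcc : Icc ((a₁, 0) : ℝ × ℝ) (a₂, β) = Icc a₁ a₂ ×ˢ Icc 0 β := by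
    rw [Icc_prod_eq]
  have hae : (Ioo a₁ a₂ ×ˢ Ioo 0 β : Set (ℝ × ℝ)) =ᵐ[volume] Icc a₁ a₂ ×ˢ Icc 0 β :=
    Measure.set_prod_ae_eq Ioo_ae_eq_Icc Ioo_ae_eq_Icc
  have hcos : ∀ x ∈ Icc a₁ a₂, Real.cos (c * (x - m)) ≠ 0 := fun x hx =>
    (Real.cos_pos_of_mem_Ioo ⟨by nlinarith [hx.1, hx.2], by nlinarith [hx.1, hx.2]⟩).ne'
  have htan : ContinuousOn (fun p : ℝ × ℝ => Real.tan (c * (p.1 - m)))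
      (Icc a₁ a₂ ×ˢ Icc 0 β) := by
    intro p hp
    refine ContinuousAt.continuousWithinAt ?_
    exact (Real.continuousAt_tan.2 (hcos p.1 hp.1)).comp
      (f := fun p : ℝ × ℝ => c * (p.1 - m)) (by fun_prop)
  have hK : IsCompact (Icc a₁ a₂ ×ˢ Icc (0:ℝ) β) := isCompact_Icc.prod isCompact_Icc
  have hi' := hi.congr_set_ae hae.symm
  have hX := integrableOn_of_sq_add_sq hK (measurable_fderiv_apply_const ℝ w (1, 0))
    (hi'.congr_fun (fun p _ => rfl) hK.measurableSet)
  have hY := integrableOn_of_sq_add_sq hK (measurable_fderiv_apply_const ℝ w (0, 1))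
    (hi'.congr_fun (fun p _ => add_comm _ _) hK.measurableSet)
  let F : ℝ × ℝ → ℝ := fun p => c * (w p ^ 2 * Real.tan (c * (p.1 - m)))
  let G : ℝ × ℝ → ℝ := fun p => c * w p ^ 2
  let F' : ℝ × ℝ → ℝ × ℝ →L[ℝ] ℝ := fun p =>
    (2 * c * w p * Real.tan (c * (p.1 - m))) • fderiv ℝ w p +
      (c ^ 2 * w p ^ 2 * (1 + Real.tan (c * (p.1 - m)) ^ 2)) • ContinuousLinearMap.fst ℝ ℝ ℝ
  let G' : ℝ × ℝ → ℝ × ℝ →L[ℝ] ℝ := fun p => (2 * c * w p) • fderiv ℝ w p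
  have hwd : ∀ p ∈ Ioo a₁ a₂ ×ˢ Ioo 0 β, HasFDerivAt w (fderiv ℝ w p) p := fun p hp =>
    (hd.differentiableAt ((isOpen_Ioo.prod isOpen_Ioo).mem_nhds hp)).hasFDerivAt
  have hdivint : IntegrableOn (fun p => F' p (1, 0) + G' p (0, 1)) (Icc a₁ a₂ ×ˢ Icc 0 β) := by
    have e : (fun p => F' p (1, 0) + G' p (0, 1)) = fun p =>
        ((2 * c * w p * Real.tan (c * (p.1 - m))) * fderiv ℝ w p (1, 0) +
        (c ^ 2 * w p ^ 2 * (1 + Real.tan (c * (p.1 - m)) ^ 2))) +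
        (2 * c * w p) * fderiv ℝ w p (0, 1) := by
      funext p; simp [F', G']
    rw [e]
    refine ((hX.continuousOn_mul ?_ hK).add (ContinuousOn.integrableOn_compact hK ?_)).add
      (hY.continuousOn_mul ?_ hK) <;> fun_prop
  have key := integral_divergence_prod_Icc_of_hasFDerivAt_off_countable_of_le F G F' G'
    (a₁, 0) (a₂, β) ⟨ha.le, hβ.le⟩ ∅ countable_empty
    (by rw [hIcc]; fun_prop) (by rw [hIcc]; fun_prop)
    (fun p hp => by
      have hx := hcos p.1 (Ioo_subset_Icc_self hp.1.1)
      have h1 : HasFDerivAt (fun p : ℝ × ℝ => c * (p.1 - m)) (c • ContinuousLinearMap.fst ℝ ℝ ℝ) p :=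
        (hasFDerivAt_fst.sub_const m).const_mul c
      have h2 := (Real.hasDerivAt_tan hx).comp_hasFDerivAt p h1
      have h3 := (((hwd p hp.1).pow 2).mul h2).const_mul c
      refine h3.congr_fderiv ?_
      ext <;> simp [F', ← Real.inv_one_add_tan_sq hx] <;> ring)
    (fun p hp => by
      have h3 := ((hwd p hp.1).pow 2).const_mul c
      refine h3.congr_fderiv ?_
      ext <;> simp [G'] <;> ring)
    (by rw [hIcc]; exact hdivint)
  simp only [hIcc] at key
  have hF : ∀ s, (∀ t ∈ Icc 0 β, w (s, t) = 0) → ∫ t in (0:ℝ)..β, F (s, t) = 0 := by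
    intro s hs
    calc ∫ t in (0:ℝ)..β, F (s, t) = ∫ _ in (0:ℝ)..β, (0:ℝ) :=
          intervalIntegral.integral_congr fun t ht => by
            rw [uIcc_of_le hβ.le] at ht
            simp [F, hs t ht]
      _ = 0 := by simp
  have hG : ∀ t, ∫ x in a₁..a₂, G (x, t) = c * ∫ x in a₁..a₂, w (x, t) ^ 2 := fun t => by
    simp [G]
  rw [hF a₁ h₁, hF a₂ h₂, hG, hG] at key
  have hmono : ∫ p in Icc a₁ a₂ ×ˢ Icc 0 β, -(F' p (1, 0) + G' p (0, 1)) ≤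
      ∫ p in Icc a₁ a₂ ×ˢ Icc 0 β,
        ((fderiv ℝ w p (1, 0)) ^ 2 + (fderiv ℝ w p (0, 1)) ^ 2) := by
    refine integral_mono hdivint.neg hi' fun p => ?_
    simp only [F', G', add_apply, smul_apply,
      ContinuousLinearMap.coe_fst', smul_eq_mul]
    nlinarith [sq_nonneg (fderiv ℝ w p (1, 0) + c * w p * Real.tan (c * (p.1 - m))),
      sq_nonneg (fderiv ℝ w p (0, 1) + c * w p)]
  rw [integral_neg, key] at hmono
  rw [setIntegral_congr_set hae]
  linarith

/-- the shear `(x, t) ↦ (x, k x + t)` straightening the graph of `k` -/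
def shear (k : ℝ → ℝ) (hk : Continuous k) : (ℝ × ℝ) ≃ₜ (ℝ × ℝ) where
  toFun p := (p.1, k p.1 + p.2)
  invFun p := (p.1, p.2 - k p.1)
  left_inv p := by simp
  right_inv p := by simp
  continuous_toFun := by fun_prop
  continuous_invFun := by fun_prop

theorem measurePreserving_shear (k : ℝ → ℝ) (hk : Continuous k) :
    MeasurePreserving (shear k hk) := by
  refine (MeasurePreserving.id volume).skew_product (g := fun x t => k x + t)
    (Continuous.measurable (by fun_prop)) (.of_forall fun x => ?_)
  exact (measurePreserving_add_left volume (k x)).map_eq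

theorem graphRegion_eq_preimage {g : ℝ → ℝ} (hg : Continuous g) (a₁ a₂ b : ℝ) :
    graphRegion g a₁ a₂ b = (shear g hg).symm ⁻¹' (Ioo a₁ a₂ ×ˢ Ioo 0 b) := by
  ext p
  simp only [graphRegion, shear, mem_ofPred_eq, mem_preimage, mem_prod, mem_Ioo,
    Homeomorph.symm, Homeomorph.homeomorph_mk_coe, Equiv.symm, Equiv.coe_fn_mk]
  constructor <;> rintro ⟨h, h1, h2⟩ <;> exact ⟨h, by linarith, by linarith⟩

theorem isOpen_graphRegion {g : ℝ → ℝ} (hg : Continuous g) (a₁ a₂ b : ℝ) :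
    IsOpen (graphRegion g a₁ a₂ b) := by
  rw [graphRegion_eq_preimage hg]
  exact (isOpen_Ioo.prod isOpen_Ioo).preimage (Homeomorph.continuous _)

theorem closure_graphRegion {g : ℝ → ℝ} (hg : Continuous g) {a₁ a₂ b : ℝ} (ha : a₁ < a₂)
    (hb : 0 < b) :
    closure (graphRegion g a₁ a₂ b) =
      {p | p.1 ∈ Icc a₁ a₂ ∧ g p.1 ≤ p.2 ∧ p.2 ≤ g p.1 + b} := by
  rw [graphRegion_eq_preimage hg, ← Homeomorph.preimage_closure, closure_prod_eq,
    closure_Ioo ha.ne, closure_Ioo hb.ne]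
  ext p
  simp only [shear, mem_ofPred_eq, mem_preimage, mem_prod, mem_Icc,
    Homeomorph.symm, Homeomorph.homeomorph_mk_coe, Equiv.symm, Equiv.coe_fn_mk]
  constructor <;> rintro ⟨h, h1, h2⟩ <;> exact ⟨h, by linarith, by linarith⟩

theorem isCompact_closure_graphRegion {g : ℝ → ℝ} (hg : Continuous g) (a₁ a₂ b : ℝ) :
    IsCompact (closure (graphRegion g a₁ a₂ b)) := by
  rw [graphRegion_eq_preimage hg, ← Homeomorph.preimage_closure, ← Homeomorph.image_eq_preimage_symm]
  refine IsCompact.image ?_ (Homeomorph.continuous _)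
  refine (isCompact_Icc.prod isCompact_Icc).of_isClosed_subset isClosed_closure
    (closure_minimal (prod_mono Ioo_subset_Icc_self Ioo_subset_Icc_self)
      (isClosed_Icc.prod isClosed_Icc))

theorem DifferentiableAt.pdX_eq {v : ℝ × ℝ → ℝ} {p : ℝ × ℝ} (h : DifferentiableAt ℝ v p) :
    pdX v p = fderiv ℝ v p (1, 0) := by
  have h1 : HasDerivAt (fun a : ℝ => (a, p.2)) ((1 : ℝ), (0 : ℝ)) p.1 :=
    (hasDerivAt_id p.1).prodMk (hasDerivAt_const p.1 p.2)
  exact (h.hasFDerivAt.comp_hasDerivAt p.1 h1).deriv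

theorem DifferentiableAt.pdY_eq {v : ℝ × ℝ → ℝ} {p : ℝ × ℝ} (h : DifferentiableAt ℝ v p) :
    pdY v p = fderiv ℝ v p (0, 1) := by
  have h1 : HasDerivAt (fun b : ℝ => (p.1, b)) ((0 : ℝ), (1 : ℝ)) p.2 :=
    (hasDerivAt_const p.2 p.1).prodMk (hasDerivAt_id p.2)
  exact (h.hasFDerivAt.comp_hasDerivAt p.2 h1).deriv

theorem energy_nonneg (A : Set (ℝ × ℝ)) (v : ℝ × ℝ → ℝ) : 0 ≤ energy A v :=
  integral_nonneg fun _ => by positivity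

theorem curve_trace_le {a₁ a₂ β c L : ℝ} (ha : a₁ < a₂) (hβ : 0 < β) (hc : 0 < c)
    (hcπ : c * (a₂ - a₁) < π) {A : Set (ℝ × ℝ)} (hA : IsOpen A) {v : ℝ × ℝ → ℝ}
    (hv : ContinuousOn v (closure A)) (hd : DifferentiableOn ℝ v A)
    (hi : IntegrableOn (fun p => (pdX v p) ^ 2 + (pdY v p) ^ 2) A)
    {k k' : ℝ → ℝ} (hk : ∀ x, HasDerivAt k (k' x) x) (hL : ∀ x, |k' x| ≤ L)
    (hIn : ∀ x ∈ Ioo a₁ a₂, ∀ t ∈ Ioo 0 β, (x, k x + t) ∈ A)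
    (hcl : ∀ x ∈ Icc a₁ a₂, ∀ t ∈ Icc 0 β, (x, k x + t) ∈ closure A)
    (h₁ : ∀ t ∈ Icc 0 β, v (a₁, k a₁ + t) = 0) (h₂ : ∀ t ∈ Icc 0 β, v (a₂, k a₂ + t) = 0) :
    c * ((∫ x in a₁..a₂, v (x, k x) ^ 2) - ∫ x in a₁..a₂, v (x, k x + β) ^ 2) ≤
      (2 + L ^ 2) * energy A v := by
  have hkc : Continuous k := continuous_iff_continuousAt.2 fun x => (hk x).continuousAt
  set ψ := shear k hkc with hψ
  have hψe : ∀ p, ψ p = (p.1, k p.1 + p.2) := fun p => rfl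
  set S : Set (ℝ × ℝ) := Ioo a₁ a₂ ×ˢ Ioo 0 β with hS
  have hSm : MeasurableSet S := measurableSet_Ioo.prod measurableSet_Ioo
  have hSA : ψ '' S ⊆ A := by
    rintro _ ⟨p, hp, rfl⟩
    exact hIn p.1 hp.1 p.2 hp.2
  set e : ℝ × ℝ → ℝ := fun p => (pdX v p) ^ 2 + (pdY v p) ^ 2 with he
  have hmp := measurePreserving_shear k hkc
  have hemb : MeasurableEmbedding ψ := ψ.measurableEmbedding
  have hei : IntegrableOn (e ∘ ψ) S :=
    (hmp.integrableOn_image hemb).1 (hi.mono_set hSA)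
  have hψd : ∀ p, HasFDerivAt ψ ((ContinuousLinearMap.fst ℝ ℝ ℝ).prod
      (k' p.1 • ContinuousLinearMap.fst ℝ ℝ ℝ + ContinuousLinearMap.snd ℝ ℝ ℝ)) p := fun p =>
    hasFDerivAt_fst.prodMk (((hk p.1).comp_hasFDerivAt p hasFDerivAt_fst).add hasFDerivAt_snd)
  have hvd : ∀ p ∈ S, DifferentiableAt ℝ v (ψ p) := fun p hp =>
    hd.differentiableAt (hA.mem_nhds (hSA ⟨p, hp, rfl⟩))
  have hw : ∀ p ∈ S, HasFDerivAt (v ∘ ψ) ((fderiv ℝ v (ψ p)).comp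
      ((ContinuousLinearMap.fst ℝ ℝ ℝ).prod
      (k' p.1 • ContinuousLinearMap.fst ℝ ℝ ℝ + ContinuousLinearMap.snd ℝ ℝ ℝ))) p := fun p hp =>
    (hvd p hp).hasFDerivAt.comp p (hψd p)
  have hle : ∀ p ∈ S, (fderiv ℝ (v ∘ ψ) p (1, 0)) ^ 2 + (fderiv ℝ (v ∘ ψ) p (0, 1)) ^ 2 ≤
      (2 + L ^ 2) * (e ∘ ψ) p := by
    intro p hp
    have e1 : ((1 : ℝ), k' p.1) = (1, 0) + k' p.1 • (0, 1) := by simp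
    have hk2 : k' p.1 ^ 2 ≤ L ^ 2 := sq_le_sq.2 ((hL _).trans (le_abs_self L))
    rw [(hw p hp).fderiv]
    simp only [ContinuousLinearMap.comp_apply, ContinuousLinearMap.prod_apply, add_apply,
      smul_apply, ContinuousLinearMap.coe_fst', ContinuousLinearMap.coe_snd', smul_eq_mul,
      mul_one, mul_zero, add_zero, zero_add, Function.comp_apply, he]
    rw [e1, map_add, map_smul, ← (hvd p hp).pdX_eq, ← (hvd p hp).pdY_eq, smul_eq_mul]
    nlinarith [sq_nonneg (k' p.1 * pdX v (ψ p) - pdY v (ψ p)),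
      mul_le_mul_of_nonneg_right hk2 (add_nonneg (sq_nonneg (pdX v (ψ p)))
        (sq_nonneg (pdY v (ψ p))))]
  have hwi : IntegrableOn (fun p => (fderiv ℝ (v ∘ ψ) p (1, 0)) ^ 2 +
      (fderiv ℝ (v ∘ ψ) p (0, 1)) ^ 2) S := by
    refine Integrable.mono' (hei.const_mul (2 + L ^ 2))
      (((measurable_fderiv_apply_const ℝ _ _).pow_const 2).add
        ((measurable_fderiv_apply_const ℝ _ _).pow_const 2)).aestronglyMeasurable ?_
    filter_upwards [ae_restrict_mem hSm] with p hp
    rw [Real.norm_of_nonneg (by positivity)]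
    exact hle p hp
  have key := rectangle_trace_le ha hβ hc hcπ (w := v ∘ ψ)
    (hv.comp ψ.continuous.continuousOn fun p hp => hcl p.1 hp.1 p.2 hp.2)
    (fun p hp => (hw p hp).differentiableAt.differentiableWithinAt) h₁ h₂ hwi
  simp only [Function.comp_apply, hψe, add_zero] at key
  refine key.trans ?_
  calc _ ≤ ∫ p in S, (2 + L ^ 2) * (e ∘ ψ) p :=
        setIntegral_mono_on hwi (hei.const_mul _) hSm hle
    _ = (2 + L ^ 2) * ∫ p in ψ '' S, e p := by
        rw [integral_const_mul, hmp.setIntegral_image_emb hemb]; rfl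
    _ ≤ (2 + L ^ 2) * energy A v := by
        refine mul_le_mul_of_nonneg_left ?_ (by positivity)
        exact setIntegral_mono_set hi (.of_forall fun p => by positivity) hSA.eventuallyLE

theorem LipschitzWith.exists_hasDerivAt_approx_above {g : ℝ → ℝ} {K : NNReal}
    (hg : LipschitzWith K g) {δ : ℝ} (hδ : 0 < δ) :
    ∃ k k' : ℝ → ℝ, (∀ x, HasDerivAt k (k' x) x) ∧ (∀ x, |k' x| ≤ K) ∧
      (∀ x, g x ≤ k x) ∧ ∀ x, k x ≤ g x + δ := by
  have hK : (0 : ℝ) ≤ K := K.2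
  set ε : ℝ := δ / (2 * K + 1) with hε
  have hε0 : 0 < ε := by positivity
  have hδε : 2 * K * ε ≤ δ := by
    have : δ = (2 * K + 1) * ε := by rw [hε]; field_simp
    nlinarith
  have hgc := hg.continuous
  have hlip : ∀ x y, |g x - g y| ≤ K * |x - y| := fun x y => by
    simpa [Real.dist_eq] using hg.dist_le_mul x y
  have hint : ∀ a b, IntervalIntegrable g volume a b := fun a b => hgc.intervalIntegrable a b
  have hd : ∀ x, HasDerivAt (fun x => ∫ s in (0:ℝ)..x, g s) (g x) x := fun x =>
    intervalIntegral.integral_hasDerivAt_right (hint _ _)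
      (hgc.stronglyMeasurableAtFilter _ _) hgc.continuousAt
  have hbd : ∀ x, |(∫ s in x..(x + ε), g s) - ε * g x| ≤ K * ε * ε := fun x => by
    have h1 : (∫ s in x..(x + ε), g s) - ε * g x = ∫ s in x..(x + ε), (g s - g x) := by
      rw [intervalIntegral.integral_sub (hint _ _) (by simp)]; simp
    rw [h1]
    have := intervalIntegral.norm_integral_le_of_norm_le_const (a := x) (b := x + ε)
      (f := fun s => g s - g x) (C := K * ε) (fun s hs => by
        rw [uIoc_of_le (by linarith)] at hs
        refine (hlip s x).trans (mul_le_mul_of_nonneg_left ?_ hK)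
        rw [abs_of_pos (by linarith [hs.1])]
        linarith [hs.2])
    simpa [abs_of_pos hε0] using this
  have hmean : ∀ x, |ε⁻¹ * (∫ s in x..(x + ε), g s) - g x| ≤ K * ε := fun x => by
    have h1 : ε⁻¹ * (∫ s in x..(x + ε), g s) - g x =
        ε⁻¹ * ((∫ s in x..(x + ε), g s) - ε * g x) := by field_simp
    rw [h1, abs_mul, abs_of_pos (inv_pos.2 hε0), inv_mul_le_iff₀ hε0]
    linarith [hbd x]
  refine ⟨fun x => ε⁻¹ * (∫ s in x..(x + ε), g s) + K * ε, fun x => ε⁻¹ * (g (x + ε) - g x),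
    fun x => ?_, fun x => ?_, fun x => ?_, fun x => ?_⟩
  · have h1 : (fun x => ∫ s in x..(x + ε), g s) =
        fun x => (∫ s in (0:ℝ)..(x + ε), g s) - ∫ s in (0:ℝ)..x, g s := by
      funext x
      rw [intervalIntegral.integral_interval_sub_left (hint _ _) (hint _ _)]
    have h2 : HasDerivAt (fun x => ∫ s in x..(x + ε), g s) (g (x + ε) - g x) x := by
      rw [h1]
      exact ((hd (x + ε)).comp_add_const x ε).sub (hd x)
    exact (h2.const_mul ε⁻¹).add_const _
  · rw [abs_mul, abs_of_pos (inv_pos.2 hε0), inv_mul_le_iff₀ hε0]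
    have := hlip (x + ε) x
    rw [add_sub_cancel_left, abs_of_pos hε0] at this
    linarith
  · linarith [(abs_le.1 (hmean x)).1]
  · linarith [(abs_le.1 (hmean x)).2]

theorem tendsto_integral_sq_curve {C : Set (ℝ × ℝ)} (hC : IsCompact C) {v : ℝ × ℝ → ℝ}
    (hv : ContinuousOn v C) {a₁ a₂ : ℝ} (ha : a₁ ≤ a₂) {s : ℕ → ℝ → ℝ} {r : ℝ → ℝ}
    (hs : ∀ n, Continuous (s n)) (hsC : ∀ n, ∀ x ∈ Icc a₁ a₂, (x, s n x) ∈ C)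
    (hrC : ∀ x ∈ Icc a₁ a₂, (x, r x) ∈ C)
    (hlim : ∀ x, Filter.Tendsto (fun n => s n x) Filter.atTop (nhds (r x))) :
    Filter.Tendsto (fun n => ∫ x in a₁..a₂, v (x, s n x) ^ 2) Filter.atTop
      (nhds (∫ x in a₁..a₂, v (x, r x) ^ 2)) := by
  obtain ⟨M, hM⟩ := hC.exists_bound_of_continuousOn hv
  have hsub : uIoc a₁ a₂ ⊆ Icc a₁ a₂ := by
    rw [uIoc_of_le ha]; exact Ioc_subset_Icc_self
  refine intervalIntegral.tendsto_integral_filter_of_dominated_convergence (fun _ => M ^ 2)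
    (.of_forall fun n => ?_) (.of_forall fun n => .of_forall fun x hx => ?_) (by simp)
    (.of_forall fun x hx => ?_)
  · refine (ContinuousOn.mono ?_ hsub).aestronglyMeasurable measurableSet_uIoc
    have hsn := hs n
    exact (hv.comp (f := fun x => (x, s n x)) (by fun_prop) fun x hx => hsC n x hx).pow 2
  · have := hM _ (hsC n x (hsub hx))
    rw [norm_pow]
    exact pow_le_pow_left₀ (norm_nonneg _) this 2
  · refine Filter.Tendsto.pow ?_ 2
    refine (hv _ (hrC x (hsub hx))).tendsto.comp ?_
    exact tendsto_nhdsWithin_iff.2 ⟨tendsto_const_nhds.prodMk_nhds (hlim x),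
      .of_forall fun n => hsC n x (hsub hx)⟩

theorem graph_trace_le {g : ℝ → ℝ} {K : NNReal} (hg : LipschitzWith K g) {a₁ a₂ b : ℝ}
    (ha : a₁ < a₂) (hb : 0 < b) {v : ℝ × ℝ → ℝ}
    (hv : v ∈ Adm (graphRegion g a₁ a₂ b) (graphSet g a₁ a₂)) :
    π / (a₂ - a₁) * (∫ x in a₁..a₂, v (x, g x) ^ 2) ≤
      (2 + (K : ℝ) ^ 2) * energy (graphRegion g a₁ a₂ b) v := by
  obtain ⟨hvc, hvd, hvi, -, hv0⟩ := hv
  have hgc := hg.continuous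
  have hcl := closure_graphRegion hgc ha hb
  have hopen := isOpen_graphRegion hgc a₁ a₂ b
  have hmem : ∀ p : ℝ × ℝ, p.1 ∈ Icc a₁ a₂ → g p.1 ≤ p.2 → p.2 ≤ g p.1 + b →
      p ∈ closure (graphRegion g a₁ a₂ b) := fun p h1 h2 h3 => by
    rw [hcl]; exact ⟨h1, h2, h3⟩
  have hside : ∀ p ∈ closure (graphRegion g a₁ a₂ b), p.1 ∉ Ioo a₁ a₂ → v p = 0 :=
    fun p hp h => hv0 p ⟨by rw [hopen.frontier_eq]; exact ⟨hp, fun hA => h hA.1⟩,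
      fun hΓ => h hΓ.1⟩
  have htop : ∀ x ∈ Icc a₁ a₂, v (x, g x + b) = 0 := fun x hx =>
    hv0 _ ⟨by
      rw [hopen.frontier_eq]
      exact ⟨hmem _ hx (by simpa using hb.le) le_rfl, fun hA => lt_irrefl _ hA.2.2⟩,
      fun hΓ => by have := hΓ.2; simp at this; exact hb.ne' this⟩
  have hδ : ∀ n : ℕ, 0 < b / ((n : ℝ) + 2) := fun n => by positivity
  have hδb : ∀ n : ℕ, b / ((n : ℝ) + 2) < b := fun n =>
    div_lt_self hb (by have : (0 : ℝ) ≤ n := n.cast_nonneg; linarith)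
  have hδ0 : Filter.Tendsto (fun n : ℕ => b / ((n : ℝ) + 2)) Filter.atTop (nhds 0) :=
    Filter.Tendsto.div_atTop tendsto_const_nhds
      (Filter.tendsto_atTop_add_const_right _ _ tendsto_natCast_atTop_atTop)
  choose k k' hk hkL hkg hkδ using fun n => hg.exists_hasDerivAt_approx_above (hδ n)
  have hkc : ∀ n, Continuous (k n) := fun n =>
    continuous_iff_continuousAt.2 fun x => (hk n x).continuousAt
  have hklim : ∀ x, Filter.Tendsto (fun n => k n x) Filter.atTop (nhds (g x)) := fun x =>
    tendsto_of_tendsto_of_tendsto_of_le_of_le tendsto_const_nhds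
      (by simpa using hδ0.const_add (g x)) (fun n => hkg n x) (fun n => hkδ n x)
  have hconst : ∀ c : ℝ, 0 < c → c * (a₂ - a₁) < π →
      c * (∫ x in a₁..a₂, v (x, g x) ^ 2) ≤
        (2 + (K : ℝ) ^ 2) * energy (graphRegion g a₁ a₂ b) v := by
    intro c hc hcπ
    have hbound := fun n => curve_trace_le ha (sub_pos.2 (hδb n)) hc hcπ hopen hvc hvd hvi
      (hk n) (hkL n)
      (fun x hx t ht => ⟨hx, by dsimp; linarith [hkg n x, ht.1], by
        dsimp; linarith [hkδ n x, ht.2]⟩)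
      (fun x hx t ht => hmem _ hx (by dsimp; linarith [hkg n x, ht.1]) (by
        dsimp; linarith [hkδ n x, ht.2]))
      (fun t ht => hside _ (hmem _ ⟨le_rfl, ha.le⟩ (by dsimp; linarith [hkg n a₁, ht.1]) (by
        dsimp; linarith [hkδ n a₁, ht.2])) (by simp))
      (fun t ht => hside _ (hmem _ ⟨ha.le, le_rfl⟩ (by dsimp; linarith [hkg n a₂, ht.1]) (by
        dsimp; linarith [hkδ n a₂, ht.2])) (by simp))
    have hC := isCompact_closure_graphRegion hgc a₁ a₂ b
    have l1 := tendsto_integral_sq_curve hC hvc ha.le hkc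
      (fun n x hx => hmem _ hx (hkg n x) (by dsimp; linarith [hkδ n x, hδb n]))
      (fun x hx => hmem _ hx le_rfl (by simpa using hb.le)) hklim
    have l2 := tendsto_integral_sq_curve hC hvc ha.le
      (s := fun n x => k n x + (b - b / ((n : ℝ) + 2))) (r := fun x => g x + b)
      (fun n => (hkc n).add continuous_const)
      (fun n x hx => hmem _ hx (by dsimp; linarith [hkg n x, hδb n])
        (by dsimp; linarith [hkδ n x]))
      (fun x hx => hmem _ hx (by simpa using hb.le) le_rfl)
      (fun x => by simpa using (hklim x).add (hδ0.const_sub b))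
    have h0 : ∫ x in a₁..a₂, v (x, g x + b) ^ 2 = 0 := by
      calc _ = ∫ _ in a₁..a₂, (0 : ℝ) := intervalIntegral.integral_congr fun x hx => by
            rw [uIcc_of_le ha.le] at hx
            simp [htop x hx]
        _ = 0 := by simp
    rw [h0] at l2
    have := le_of_tendsto' ((l1.sub l2).const_mul c) hbound
    simpa using this
  have hℓ : 0 < a₂ - a₁ := sub_pos.2 ha
  have hlim : Filter.Tendsto (fun c : ℝ => c * ∫ x in a₁..a₂, v (x, g x) ^ 2)
      (nhdsWithin (π / (a₂ - a₁)) (Iio (π / (a₂ - a₁))))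
      (nhds (π / (a₂ - a₁) * ∫ x in a₁..a₂, v (x, g x) ^ 2)) :=
    (Continuous.tendsto (by fun_prop) _).mono_left nhdsWithin_le_nhds
  refine le_of_tendsto hlim ?_
  filter_upwards [Ioo_mem_nhdsLT (show (0 : ℝ) < π / (a₂ - a₁) by positivity)] with c hc
  exact hconst c hc.1 ((lt_div_iff₀ hℓ).1 hc.2)

theorem hausdorffMeasure_restrict_graphSet_le {g : ℝ → ℝ} {K : NNReal} (hg : LipschitzWith K g)
    (a₁ a₂ : ℝ) :
    (μH[1] : Measure (ℝ × ℝ)).restrict (graphSet g a₁ a₂) ≤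
      ((max 1 K : NNReal) : ENNReal) •
        (volume.restrict (Ioo a₁ a₂)).map (fun x => (x, g x)) := by
  have hγ : LipschitzWith (max 1 K) (fun x => (x, g x)) := LipschitzWith.id.prodMk hg
  have hγm := hγ.continuous.measurable
  refine Measure.le_iff.2 fun E hE => ?_
  rw [Measure.restrict_apply hE, Measure.smul_apply, Measure.map_apply hγm hE,
    Measure.restrict_apply (hγm hE)]
  have hsub : E ∩ graphSet g a₁ a₂ ⊆
      (fun x => (x, g x)) '' ((fun x => (x, g x)) ⁻¹' E ∩ Ioo a₁ a₂) := by
    rintro ⟨x, y⟩ ⟨hE, hx, hy⟩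
    dsimp at hx hy
    subst hy
    exact ⟨x, ⟨hE, hx⟩, rfl⟩
  refine (measure_mono hsub).trans ?_
  simpa [hausdorffMeasure_real] using hγ.hausdorffMeasure_image_le zero_le_one
    ((fun x => (x, g x)) ⁻¹' E ∩ Ioo a₁ a₂)

theorem bInt_graphSet_le {g : ℝ → ℝ} {K : NNReal} (hg : LipschitzWith K g) {a₁ a₂ : ℝ}
    (ha : a₁ ≤ a₂) {v : ℝ × ℝ → ℝ} (hv : ContinuousOn (fun x => v (x, g x)) (Icc a₁ a₂)) :
    bInt (graphSet g a₁ a₂) v ≤ max 1 (K : ℝ) * ∫ x in a₁..a₂, v (x, g x) ^ 2 := by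
  have hγc : Continuous (fun x => (x, g x)) := continuous_id.prodMk hg.continuous
  have hemb : MeasurableEmbedding (fun x => (x, g x)) :=
    hγc.measurableEmbedding fun x y h => (Prod.ext_iff.1 h).1
  have hint : Integrable (fun p => v p ^ 2)
      ((volume.restrict (Ioo a₁ a₂)).map (fun x => (x, g x))) := by
    rw [hemb.integrable_map_iff]
    exact ((hv.pow 2).integrableOn_compact isCompact_Icc).mono_set Ioo_subset_Icc_self
  refine (integral_mono_measure (hausdorffMeasure_restrict_graphSet_le hg a₁ a₂)
    (.of_forall fun p => sq_nonneg _) (hint.smul_measure ENNReal.coe_ne_top)).trans_eq ?_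
  rw [integral_smul_measure, hemb.integral_map, intervalIntegral.integral_of_le ha,
    integral_Ioc_eq_integral_Ioo, ENNReal.coe_toReal, NNReal.coe_max, NNReal.coe_one, smul_eq_mul]

theorem measurableSet_graphSet {g : ℝ → ℝ} (hg : Continuous g) (a₁ a₂ : ℝ) :
    MeasurableSet (graphSet g a₁ a₂) :=
  (measurable_fst measurableSet_Ioo).inter
    (measurableSet_eq_fun measurable_snd (hg.measurable.comp measurable_fst))

theorem Adm_graphRegion_nonempty {g : ℝ → ℝ} {K : NNReal} (hg : LipschitzWith K g)
    {a₁ a₂ b : ℝ} (ha : a₁ < a₂) (hb : 0 < b) :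
    (Adm (graphRegion g a₁ a₂ b) (graphSet g a₁ a₂)).Nonempty := by
  have hgc := hg.continuous
  have hK : (0 : ℝ) ≤ K := K.2
  set x₀ : ℝ := (a₁ + a₂) / 2 with hx₀
  obtain ⟨r, hr0, hra, hrb⟩ : ∃ r : ℝ, 0 < r ∧ r ≤ (a₂ - a₁) / 2 ∧ (1 + K) * r ≤ b := by
    refine ⟨min ((a₂ - a₁) / 2) (b / (1 + K)), lt_min (by linarith) (by positivity),
      min_le_left _ _, ?_⟩
    rw [mul_comm, ← le_div_iff₀ (by positivity)]
    exact min_le_right _ _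
  let f : ContDiffBump ((x₀, g x₀) : ℝ × ℝ) := ⟨r / 2, r, by positivity, by linarith⟩
  have hfd : ContDiff ℝ 1 f := f.contDiff
  set Γ := graphSet g a₁ a₂ with hΓ
  set A := graphRegion g a₁ a₂ b with hA
  have hΓfin : μH[1] Γ < ⊤ := by
    have h1 := hausdorffMeasure_restrict_graphSet_le hg a₁ a₂ univ
    rw [Measure.restrict_apply_univ] at h1
    refine h1.trans_lt ?_
    rw [Measure.smul_apply, Measure.map_apply (by fun_prop) .univ]
    simp [ENNReal.mul_lt_top]
  have hfin : IsFiniteMeasure ((μH[1] : Measure (ℝ × ℝ)).restrict Γ) :=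
    ⟨by simpa using hΓfin⟩
  have hint : IntegrableOn (fun p => f p ^ 2) Γ μH[1] := by
    refine Integrable.of_bound (C := 1)
      (f.continuous.pow 2).measurable.aestronglyMeasurable (.of_forall fun p => ?_)
    rw [norm_pow, Real.norm_of_nonneg f.nonneg]
    exact pow_le_one₀ f.nonneg f.le_one
  have hpos : 0 < bInt Γ f := by
    refine (setIntegral_pos_iff_support_of_nonneg_ae (.of_forall fun p => sq_nonneg _) hint).2 ?_
    set U : Set ℝ := Ioo a₁ a₂ ∩ (fun x => (x, g x)) ⁻¹' Metric.ball (x₀, g x₀) r with hU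
    have hUo : IsOpen U := isOpen_Ioo.inter (Metric.isOpen_ball.preimage (by fun_prop))
    have hUx : x₀ ∈ U := ⟨⟨by linarith, by linarith⟩, Metric.mem_ball_self hr0⟩
    have hsub : U ⊆ Prod.fst '' (Function.support (fun p => f p ^ 2) ∩ Γ) := fun x hx =>
      ⟨(x, g x), ⟨pow_ne_zero 2 (f.pos_of_mem_ball hx.2).ne', hx.1, rfl⟩, rfl⟩
    have hle := LipschitzWith.prod_fst (α := ℝ) (β := ℝ) |>.hausdorffMeasure_image_le
      (d := 1) zero_le_one (Function.support (fun p => f p ^ 2) ∩ Γ)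
    rw [hausdorffMeasure_real] at hle
    simp only [ENNReal.coe_one, ENNReal.one_rpow, one_mul] at hle
    exact (hUo.measure_pos volume ⟨x₀, hUx⟩).trans_le ((measure_mono hsub).trans hle)
  set s : ℝ := (√(bInt Γ f))⁻¹ with hs
  have hvd : ContDiff ℝ 1 (fun p => s * f p) := contDiff_const.mul hfd
  have hdiff : Differentiable ℝ (fun p => s * f p) := hvd.differentiable one_ne_zero
  refine ⟨fun p => s * f p, hvd.continuous.continuousOn, hdiff.differentiableOn, ?_, ?_, ?_⟩
  · have hfc := hvd.continuous_fderiv one_ne_zero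
    have e : (fun p => (pdX (fun p => s * f p) p) ^ 2 + (pdY (fun p => s * f p) p) ^ 2) =
        fun p => (fderiv ℝ (fun p => s * f p) p (1, 0)) ^ 2 +
          (fderiv ℝ (fun p => s * f p) p (0, 1)) ^ 2 := by
      funext p
      rw [(hdiff p).pdX_eq, (hdiff p).pdY_eq]
    rw [e]
    refine IntegrableOn.mono_set (ContinuousOn.integrableOn_compact
      (isCompact_closure_graphRegion hgc a₁ a₂ b) ?_) subset_closure
    exact Continuous.continuousOn (((hfc.clm_apply continuous_const).pow 2).add
      ((hfc.clm_apply continuous_const).pow 2))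
  · have e : bInt Γ (fun p => s * f p) = s ^ 2 * bInt Γ f := by
      simp only [bInt, mul_pow, integral_const_mul]
    rw [e, hs, inv_pow, Real.sq_sqrt hpos.le, inv_mul_cancel₀ hpos.ne']
  · rintro p ⟨hp, hpΓ⟩
    rw [(isOpen_graphRegion hgc a₁ a₂ b).frontier_eq, closure_graphRegion hgc ha hb] at hp
    obtain ⟨⟨hp1, hp2, hp3⟩, hpA⟩ := hp
    have hdist : r ≤ dist p (x₀, g x₀) := by
      by_contra! hlt
      rw [Prod.dist_eq, max_lt_iff, Real.dist_eq, Real.dist_eq, abs_lt, abs_lt] at hlt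
      obtain ⟨⟨h1, h2⟩, h3, h4⟩ := hlt
      dsimp only at h1 h2 h3 h4
      have hIoo : p.1 ∈ Ioo a₁ a₂ := ⟨by linarith, by linarith⟩
      have hlow : g p.1 < p.2 := lt_of_le_of_ne hp2 fun h => hpΓ ⟨hIoo, h.symm⟩
      have hlip : |g p.1 - g x₀| ≤ K * |p.1 - x₀| := by
        simpa [Real.dist_eq] using hg.dist_le_mul p.1 x₀
      have h5 : |p.1 - x₀| ≤ r := abs_le.2 ⟨h1.le, h2.le⟩
      have h6 := (abs_le.1 (hlip.trans (mul_le_mul_of_nonneg_left h5 hK))).1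
      exact hpA ⟨hIoo, hlow, by linarith⟩
    simp [f.zero_of_le_dist hdist]

theorem two_add_sq_mul_max_le (L : ℝ) :
    (2 + L ^ 2) * max 1 L ≤ 2 * (1 + L ^ 2) ^ ((3 : ℝ) / 2) := by
  have h0 : 0 < 1 + L ^ 2 := by positivity
  have h1 : (1 + L ^ 2) ^ ((3 : ℝ) / 2) = (1 + L ^ 2) * √(1 + L ^ 2) := by
    rw [show (3 : ℝ) / 2 = 1 + 1 / 2 by norm_num, Real.rpow_add h0, Real.rpow_one,
      Real.sqrt_eq_rpow]
  have h2 : max 1 L ≤ √(1 + L ^ 2) :=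
    max_le (Real.le_sqrt_of_sq_le (by nlinarith)) (Real.le_sqrt_of_sq_le (by nlinarith))
  rw [h1]
  calc (2 + L ^ 2) * max 1 L ≤ (2 * (1 + L ^ 2)) * √(1 + L ^ 2) :=
        mul_le_mul (by nlinarith) h2 (by positivity) (by positivity)
    _ = _ := by ring

theorem Kconst_graphRegion_ge {g : ℝ → ℝ} {K : NNReal} (hg : LipschitzWith K g)
    {a₁ a₂ b : ℝ} (ha : a₁ < a₂) (hb : 0 < b) :
    (1 + (K : ℝ) ^ 2) ^ (-(3 : ℝ) / 2) * π / (2 * (a₂ - a₁)) ≤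
      Kconst (graphSet g a₁ a₂) (graphRegion g a₁ a₂ b) := by
  refine le_csInf ((Adm_graphRegion_nonempty hg ha hb).image _) ?_
  rintro _ ⟨v, hv, rfl⟩
  set E := energy (graphRegion g a₁ a₂ b) v with hE
  have hE0 : 0 ≤ E := energy_nonneg _ _
  have hℓ : 0 < a₂ - a₁ := sub_pos.2 ha
  have htrace := graph_trace_le hg ha hb hv
  have hbd := bInt_graphSet_le hg ha.le (v := v) (hv.1.comp (f := fun x => (x, g x))
    (continuous_id.prodMk hg.continuous).continuousOn fun x hx => by
      rw [closure_graphRegion hg.continuous ha hb]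
      exact ⟨hx, le_rfl, by simpa using hb.le⟩)
  rw [hv.2.2.2.1] at hbd
  set J := ∫ x in a₁..a₂, v (x, g x) ^ 2 with hJ
  set P := (1 + (K : ℝ) ^ 2) ^ ((3 : ℝ) / 2) with hP
  have hP0 : 0 < P := Real.rpow_pos_of_pos (by positivity) _
  have hrew : (1 + (K : ℝ) ^ 2) ^ (-(3 : ℝ) / 2) = P⁻¹ := by
    rw [neg_div, Real.rpow_neg (by positivity)]
  have hmain : π / (a₂ - a₁) ≤ 2 * P * E :=
    calc π / (a₂ - a₁) = π / (a₂ - a₁) * 1 := (mul_one _).symm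
      _ ≤ π / (a₂ - a₁) * (max 1 (K : ℝ) * J) :=
        mul_le_mul_of_nonneg_left hbd (by positivity)
      _ = max 1 (K : ℝ) * (π / (a₂ - a₁) * J) := by ring
      _ ≤ max 1 (K : ℝ) * ((2 + (K : ℝ) ^ 2) * E) :=
        mul_le_mul_of_nonneg_left htrace (by positivity)
      _ = ((2 + (K : ℝ) ^ 2) * max 1 (K : ℝ)) * E := by ring
      _ ≤ 2 * P * E := mul_le_mul_of_nonneg_right (two_add_sq_mul_max_le K) hE0
  rw [hrew]
  calc P⁻¹ * π / (2 * (a₂ - a₁)) = (2 * P)⁻¹ * (π / (a₂ - a₁)) := by field_simp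
    _ ≤ (2 * P)⁻¹ * (2 * P * E) := mul_le_mul_of_nonneg_left hmain (by positivity)
    _ = E := by field_simp

/-- for a Lipschitz `g : [0,a₀] → [0,∞)` with Lipschitz constant `L`
(`= ‖g'‖_∞`), `K(Γ(a₁,a₂), R(a₁,a₂,b)) ≥ (1+L²)^{-3/2}·π/(2(a₂−a₁))`; in
particular `K → +∞` as `a₂ − a₁ → 0`, uniformly in `b`. -/
theorem stmt15 (a₀ L : ℝ) (ha₀ : 0 < a₀) (hL : 0 ≤ L) (g : ℝ → ℝ)
    (hg : LipschitzOnWith (Real.toNNReal L) g (Icc 0 a₀))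
    (hgpos : ∀ x ∈ Icc (0:ℝ) a₀, 0 ≤ g x) :
    (∀ a₁ a₂ b : ℝ, 0 ≤ a₁ → a₁ < a₂ → a₂ ≤ a₀ → 0 < b →
      Kconst (graphSet g a₁ a₂) (graphRegion g a₁ a₂ b)
        ≥ (1 + L ^ 2) ^ (-(3:ℝ)/2) * π / (2 * (a₂ - a₁))) ∧
    ∀ M : ℝ, ∃ h > 0, ∀ a₁ a₂ b : ℝ, 0 ≤ a₁ → a₁ < a₂ → a₂ ≤ a₀ → 0 < b →
      a₂ - a₁ ≤ h → Kconst (graphSet g a₁ a₂) (graphRegion g a₁ a₂ b) ≥ M := by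
  obtain ⟨G, hG, hgG⟩ := hg.extend_real
  have hmain : ∀ a₁ a₂ b : ℝ, 0 ≤ a₁ → a₁ < a₂ → a₂ ≤ a₀ → 0 < b →
      Kconst (graphSet g a₁ a₂) (graphRegion g a₁ a₂ b)
        ≥ (1 + L ^ 2) ^ (-(3:ℝ)/2) * π / (2 * (a₂ - a₁)) := by
    intro a₁ a₂ b h1 ha h2 hb
    have heq : ∀ x ∈ Ioo a₁ a₂, g x = G x := fun x hx =>
      hgG ⟨h1.trans hx.1.le, hx.2.le.trans h2⟩
    have hΓ : graphSet g a₁ a₂ = graphSet G a₁ a₂ := by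
      ext p
      exact and_congr_right fun hp => by rw [heq _ hp]
    have hR : graphRegion g a₁ a₂ b = graphRegion G a₁ a₂ b := by
      ext p
      exact and_congr_right fun hp => by rw [heq _ hp]
    have key := Kconst_graphRegion_ge hG ha hb
    rw [Real.coe_toNNReal L hL] at key
    rw [hΓ, hR]
    exact key
  refine ⟨hmain, fun M => ?_⟩
  set C : ℝ := (1 + L ^ 2) ^ (-(3:ℝ)/2) * π with hC
  have hC0 : 0 < C := mul_pos (Real.rpow_pos_of_pos (by positivity) _) Real.pi_pos
  refine ⟨C / (2 * (|M| + 1)), by positivity, fun a₁ a₂ b h1 ha h2 hb hh => ?_⟩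
  refine le_trans ?_ (hmain a₁ a₂ b h1 ha h2 hb)
  have hℓ : 0 < a₂ - a₁ := sub_pos.2 ha
  rw [le_div_iff₀ (by positivity)]
  rw [le_div_iff₀ (by positivity)] at hh
  nlinarith [le_abs_self M]
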